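/- Fix positive integers I, J, K, R, D and reals q, α, β > 0, and let X(R,g) be the solution set for a map g. Suppose the observed tensor is Y = X♮ + N where |X♮(i,j,k)| ≤ υ and |N(i,j,k)| ≤ ν for all entries. Set ξ = (1/K)(√K(υ+ν) + Rαβ)². Let Ω be a uniformly random subset of [I]×[J] of cardinality m (1 ≤ m ≤ IJ), and set ω = 1/m − 1/(IJ) + 1/(IJ·m). For X̃ ∈ X(R,g) define L̂(X̃) = (1/(mK)) Σ_{(i,j)∈Ω} ‖Y(i,j,:) − X̃(i,j,:)‖₂², L(X̃) = (1/(IJK)) Σ_{(i,j)∈[I]×[J]} ‖Y(i,j,:) − X̃(i,j,:)‖₂², and Gap⋆(Ω) = sup_{X̃∈X(R,g)} |√(L̂(X̃)) − √(L(X̃))|. Then for every c > 0 and δ ∈ (0,1), with probability at least 1 − δ: Gap⋆(Ω) ≤ 2cR/√m + ( (ξ² ω / 2) · log( 2 N(X(R,g), cR) / δ ) )^{1/4}, where N(X(R,g), cR) denotes the smallest cardinality of a cR-net of X(R,g) in Frobenius norm (which is finite since X(R,g) is a bounded subset of a finite-dimensional space). -/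

import Mathlib

/-- The Euclidean norm of a vector in `ℝ^n`. -/
noncomputable def euclNorm {n : ℕ} (x : Fin n → ℝ) : ℝ := Real.sqrt (∑ i, x i ^ 2)

/-- The Frobenius norm of a real matrix. -/
noncomputable def frobNorm {m n : ℕ} (X : Matrix (Fin m) (Fin n) ℝ) : ℝ :=
  Real.sqrt (∑ i, ∑ j, X i j ^ 2)

/-- The Frobenius (Euclidean) norm of a tensor in `ℝ^{I×J×K}`. -/
noncomputable def tnorm {I J K : ℕ} (X : Fin I → Fin J → Fin K → ℝ) : ℝ :=
  Real.sqrt (∑ i, ∑ j, ∑ k, X i j k ^ 2)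

/-- The solution set `X(R,g)`: all tensors `Σ_{r=1}^R g(z_r) ∘ c_r` with `‖z_r‖₂ ≤ q` and
`‖c_r‖₂ ≤ α`. -/
def solSet (I J K R D : ℕ) (q α : ℝ) (g : (Fin D → ℝ) → Matrix (Fin I) (Fin J) ℝ) :
    Set (Fin I → Fin J → Fin K → ℝ) :=
  {X | ∃ (z : Fin R → Fin D → ℝ) (c : Fin R → Fin K → ℝ),
    (∀ r, euclNorm (z r) ≤ q) ∧ (∀ r, euclNorm (c r) ≤ α) ∧
    X = fun i j k => ∑ r, g (z r) i j * c r k}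

/-- The covering number `N(W, ε)` of a set `W` with respect to the norm-like function `nrm`:
the smallest cardinality of an `ε`-net of `W` contained in `W`. -/
noncomputable def coveringNumber {T : Type*} [AddCommGroup T]
    (W : Set T) (nrm : T → ℝ) (ε : ℝ) : ℕ :=
  sInf {n : ℕ | ∃ N : Finset T, ↑N ⊆ W ∧ (∀ w ∈ W, ∃ x ∈ N, nrm (w - x) ≤ ε) ∧ N.card = n}

/-- Hoeffding's lemma for the uniform distribution on a finset. -/
lemma hoeffding_finset {α : Type*} (A : Finset α) (hA : A.Nonempty)
    (x : α → ℝ) (b : ℝ) (h0 : ∀ p, 0 ≤ x p) (hb : ∀ p, x p ≤ b) (t : ℝ) :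
    ∑ p ∈ A, Real.exp (t * (x p - (∑ p ∈ A, x p) / A.card)) ≤
      A.card * Real.exp (t ^ 2 * b ^ 2 / 8) := by
  classical
  let _ : MeasurableSpace A := ⊤
  have : MeasurableSingletonClass A := ⟨fun _ => trivial⟩
  have : Nonempty A := hA.to_subtype
  have hn : (0 : ℝ) < A.card := by exact_mod_cast hA.card_pos
  have hsum : ∀ f : α → ℝ, ∫ a : A, f a ∂((PMF.uniformOfFintype A).toMeasure) =
      (∑ p ∈ A, f p) / A.card := by
    intro f
    rw [PMF.integral_eq_sum]
    simp only [PMF.uniformOfFintype_apply, ENNReal.toReal_inv, Fintype.card_coe,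
      ENNReal.toReal_natCast, smul_eq_mul]
    rw [← Finset.mul_sum, Finset.sum_coe_sort A f]
    field_simp
  have h := (ProbabilityTheory.hasSubgaussianMGF_of_mem_Icc
    (μ := (PMF.uniformOfFintype A).toMeasure) (X := fun a : A => x a) (a := 0) (b := b)
    (measurable_from_top).aemeasurable
    (Filter.Eventually.of_forall fun a => ⟨h0 a, hb a⟩)).mgf_le t
  rw [ProbabilityTheory.mgf, hsum x,
    hsum (fun p => Real.exp (t * (x p - (∑ p ∈ A, x p) / A.card))), div_le_iff₀ hn] at h
  refine h.trans (le_of_eq ?_)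
  rw [mul_comm]
  congr 2
  push_cast
  simp only [sub_zero, Real.norm_eq_abs, div_pow, sq_abs]
  ring

lemma sum_powersetCard_succ_mul {α : Type*} [DecidableEq α] (A : Finset α) (d : ℕ)
    (f : Finset α → ℝ) :
    ((d : ℝ) + 1) * ∑ s ∈ A.powersetCard (d + 1), f s =
      ∑ p ∈ A, ∑ s ∈ (A.erase p).powersetCard d, f (insert p s) := by
  have h1 : ((d : ℝ) + 1) * ∑ s ∈ A.powersetCard (d + 1), f s =
      ∑ s ∈ A.powersetCard (d + 1), ∑ p ∈ s, f s := by
    rw [Finset.mul_sum]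
    refine Finset.sum_congr rfl fun s hs => ?_
    rw [Finset.sum_const, (Finset.mem_powersetCard.1 hs).2, nsmul_eq_mul]
    push_cast
    rfl
  rw [h1, Finset.sum_sigma', Finset.sum_sigma']
  refine Finset.sum_bij' (fun a _ => ⟨a.2, a.1.erase a.2⟩) (fun a _ => ⟨insert a.1 a.2, a.1⟩)
    ?_ ?_ ?_ ?_ ?_
  · rintro ⟨s, p⟩ h
    simp only [Finset.mem_sigma, Finset.mem_powersetCard] at h ⊢
    refine ⟨h.1.1 h.2, Finset.erase_subset_erase _ h.1.1, ?_⟩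
    rw [Finset.card_erase_of_mem h.2, h.1.2]; rfl
  · rintro ⟨p, s⟩ h
    simp only [Finset.mem_sigma, Finset.mem_powersetCard] at h ⊢
    have hp : p ∉ s := fun hp => by simpa using h.2.1 hp
    refine ⟨⟨Finset.insert_subset h.1 (h.2.1.trans (Finset.erase_subset _ _)), ?_⟩,
      Finset.mem_insert_self _ _⟩
    rw [Finset.card_insert_of_notMem hp, h.2.2]
  · rintro ⟨s, p⟩ h
    simp only [Finset.mem_sigma, Finset.mem_powersetCard] at h ⊢
    rw [Finset.insert_erase h.2]
  · rintro ⟨p, s⟩ h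
    simp only [Finset.mem_sigma, Finset.mem_powersetCard] at h ⊢
    have hp : p ∉ s := fun hp => by simpa using h.2.1 hp
    rw [Finset.erase_insert hp]
  · rintro ⟨s, p⟩ h
    simp only [Finset.mem_sigma, Finset.mem_powersetCard] at h ⊢
    rw [Finset.insert_erase h.2]

/-- Serfling's mgf bound for sampling without replacement. -/
lemma serfling_mgf {α : Type*} [DecidableEq α] (x : α → ℝ) (b : ℝ) (h0 : ∀ p, 0 ≤ x p)
    (hb : ∀ p, x p ≤ b) (t : ℝ) (a : ℕ) (ha : 1 ≤ a) (d : ℕ) :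
    ∀ A : Finset α, A.card = a + d →
      ∑ s ∈ A.powersetCard d, Real.exp (t * (∑ p ∈ s, x p - d * ((∑ p ∈ A, x p) / A.card))) ≤
        ((a + d).choose d : ℝ) *
          Real.exp (t ^ 2 * b ^ 2 / 8 * (((a : ℝ) + 1) * d / (a + d))) := by
  induction d with
  | zero => intro A hA; simp
  | succ d ih =>
    intro A hA
    have ha' : (1 : ℝ) ≤ a := by exact_mod_cast ha
    have hd0 : (0 : ℝ) ≤ d := Nat.cast_nonneg d
    have hAne : A.Nonempty := by rw [← Finset.card_pos]; omega
    have hAc : (A.card : ℝ) = a + d + 1 := by rw [hA]; push_cast; ring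
    set M := (∑ p ∈ A, x p) / A.card with hM
    have hMs : ∑ p ∈ A, x p = (a + d + 1) * M := by
      rw [hM, hAc]; field_simp
    have hstep : ∀ p ∈ A, ∑ s ∈ (A.erase p).powersetCard d,
        Real.exp (t * (∑ p ∈ insert p s, x p - ((d + 1 : ℕ) : ℝ) * M)) ≤
        Real.exp ((t * (a / (a + d))) * (x p - M)) * (((a + d).choose d : ℝ) *
          Real.exp (t ^ 2 * b ^ 2 / 8 * (((a : ℝ) + 1) * d / (a + d)))) := by
      intro p hp
      have hc : (A.erase p).card = a + d := by
        rw [Finset.card_erase_of_mem hp, hA]; rfl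
      have := ih (A.erase p) hc
      refine le_trans (le_of_eq ?_) (mul_le_mul_of_nonneg_left this (Real.exp_pos _).le)
      rw [Finset.mul_sum]
      refine Finset.sum_congr rfl fun s hs => ?_
      have hps : p ∉ s := fun h => by
        simpa using (Finset.mem_powersetCard.1 hs).1 h
      have he : ∑ q ∈ A.erase p, x q = (a + d + 1) * M - x p := by
        rw [← hMs, ← Finset.add_sum_erase A x hp]; ring
      rw [← Real.exp_add, Finset.sum_insert hps, hc, he]
      congr 1
      push_cast
      field_simp
      ring
    have hsum : ((d : ℝ) + 1) * ∑ s ∈ A.powersetCard (d + 1),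
        Real.exp (t * (∑ p ∈ s, x p - ((d + 1 : ℕ) : ℝ) * M)) ≤
        ((d : ℝ) + 1) * (((a + (d + 1)).choose (d + 1) : ℝ) *
          Real.exp (t ^ 2 * b ^ 2 / 8 * (((a : ℝ) + 1) * ((d + 1 : ℕ) : ℝ) /
            (a + ((d + 1 : ℕ) : ℝ))))) := by
      rw [sum_powersetCard_succ_mul]
      refine (Finset.sum_le_sum hstep).trans ?_
      rw [← Finset.sum_mul]
      have hH := hoeffding_finset A hAne x b h0 hb (t * (a / (a + d)))
      rw [← hM] at hH
      refine (mul_le_mul_of_nonneg_right hH (by positivity)).trans ?_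
      have hch : ((d : ℝ) + 1) * ((a + (d + 1)).choose (d + 1) : ℝ) =
          A.card * ((a + d).choose d : ℝ) := by
        rw [hA]
        have := Nat.add_one_mul_choose_eq (a + d) d
        have h2 : ((a + d + 1 : ℕ) : ℝ) * ((a + d).choose d : ℝ) =
          ((a + d + 1).choose (d + 1) : ℝ) * ((d + 1 : ℕ) : ℝ) := by exact_mod_cast this
        rw [← add_assoc, h2]; push_cast; ring
      rw [← mul_assoc (_ + 1), hch, mul_mul_mul_comm, ← Real.exp_add]
      refine mul_le_mul_of_nonneg_left (Real.exp_le_exp.2 ?_)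
        (mul_nonneg (Nat.cast_nonneg _) (Nat.cast_nonneg _))
      have key : ((a : ℝ) / (a + d)) ^ 2 + ((a : ℝ) + 1) * d / (a + d) ≤
          ((a : ℝ) + 1) * ((d + 1 : ℕ) : ℝ) / (a + ((d + 1 : ℕ) : ℝ)) := by
        push_cast
        rw [div_pow, div_add_div _ _ (by positivity) (by positivity),
          div_le_div_iff₀ (by positivity) (by positivity), ← sub_nonneg]
        have : 0 ≤ (a + d : ℝ) * (a * d) := by positivity
        refine this.trans (le_of_eq ?_)
        ring
      calc _ = t ^ 2 * b ^ 2 / 8 * (((a : ℝ) / (a + d)) ^ 2 + ((a : ℝ) + 1) * d / (a + d)) := by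
            ring
        _ ≤ _ := mul_le_mul_of_nonneg_left key (by positivity)
    exact le_of_mul_le_mul_left hsum (by positivity)

/-- One-sided Serfling tail bound (counting form). -/
lemma serfling_tail {α : Type*} [Fintype α] [DecidableEq α] (x : α → ℝ) (b : ℝ) (hb0 : 0 < b)
    (h0 : ∀ p, 0 ≤ x p) (hb : ∀ p, x p ≤ b) (m : ℕ) (hm : 1 ≤ m) (hmn : m ≤ Fintype.card α)
    (u : ℝ) (hu : 0 < u) (ε : ℝ) (hε : ε = 1 ∨ ε = -1) :
    ((((Finset.univ : Finset α).powersetCard m).filter fun s =>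
      u ≤ ε * ((∑ p ∈ s, x p) / m - (∑ p, x p) / Fintype.card α)).card : ℝ) ≤
    (((Finset.univ : Finset α).powersetCard m).card : ℝ) *
      Real.exp (- (2 * u ^ 2 / (b ^ 2 * (1 / (m : ℝ) - 1 / (Fintype.card α : ℝ) +
        1 / ((Fintype.card α : ℝ) * m))))) := by
  obtain ⟨a, ha⟩ := Nat.exists_eq_add_of_le' hmn
  have hε2 : ε ^ 2 = 1 := by rcases hε with h | h <;> rw [h] <;> norm_num
  have hm' : (0 : ℝ) < m := by exact_mod_cast hm
  rcases Nat.eq_zero_or_pos a with h | hapos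
  · have hmn' : m = Fintype.card α := by omega
    have : (((Finset.univ : Finset α).powersetCard m).filter fun s =>
      u ≤ ε * ((∑ p ∈ s, x p) / m - (∑ p, x p) / Fintype.card α)) = ∅ := by
      rw [Finset.filter_eq_empty_iff]
      intro s hs
      have : s = Finset.univ := by
        rw [← Finset.card_eq_iff_eq_univ, (Finset.mem_powersetCard.1 hs).2, hmn']
      rw [this, ← hmn', sub_self, mul_zero]
      exact not_le.2 hu
    rw [this]
    simp only [Finset.card_empty, Nat.cast_zero]
    exact mul_nonneg (Nat.cast_nonneg _) (Real.exp_pos _).le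
  have ha' : (1 : ℝ) ≤ a := by exact_mod_cast hapos
  have hn : (Fintype.card α : ℝ) = a + m := by rw [ha]; push_cast; ring
  set V : ℝ := ((a : ℝ) + 1) * m / (a + m) with hV
  have hVpos : 0 < V := by positivity
  set l : ℝ := 4 * m * u / (b ^ 2 * V) with hl
  have hlpos : 0 < l := by positivity
  have hmgf := serfling_mgf x b h0 hb (l * ε) a hapos m Finset.univ (by rw [Finset.card_univ, ha])
  have hcard : (((Finset.univ : Finset α).powersetCard m).card : ℝ) = ((a + m).choose m : ℝ) := by
    rw [Finset.card_powersetCard, Finset.card_univ, ha]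
  rw [← hcard, ← hV, mul_pow, hε2, mul_one, Finset.card_univ] at hmgf
  have hmk : ((((Finset.univ : Finset α).powersetCard m).filter fun s =>
      u ≤ ε * ((∑ p ∈ s, x p) / m - (∑ p, x p) / Fintype.card α)).card : ℝ) *
      Real.exp (l * (m * u)) ≤ ∑ s ∈ (Finset.univ : Finset α).powersetCard m,
        Real.exp (l * ε * (∑ p ∈ s, x p - m * ((∑ p, x p) / Fintype.card α))) := by
    rw [← nsmul_eq_mul, ← Finset.sum_const]
    refine (Finset.sum_le_sum ?_).trans (Finset.sum_le_sum_of_subset_of_nonneg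
      (Finset.filter_subset _ _) fun _ _ _ => (Real.exp_pos _).le)
    intro s hs
    have hs2 := (Finset.mem_filter.1 hs).2
    rw [Real.exp_le_exp]
    have h3 : l * ε * (∑ p ∈ s, x p - m * ((∑ p, x p) / Fintype.card α)) =
      l * (m * (ε * ((∑ p ∈ s, x p) / m - (∑ p, x p) / Fintype.card α))) := by
      have : (∑ p ∈ s, x p) = m * ((∑ p ∈ s, x p) / m) := by field_simp
      nth_rewrite 1 [this]
      ring
    rw [h3]
    gcongr
  have h4 := hmk.trans hmgf
  rw [← le_div_iff₀ (Real.exp_pos _), mul_div_assoc, ← Real.exp_sub] at h4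
  refine h4.trans (le_of_eq ?_)
  congr 2
  rw [hn, hl, hV]
  have hω : 1 / (m : ℝ) - 1 / (a + m) + 1 / ((a + m) * m) = ((a : ℝ) + 1) / ((a + m) * m) := by
    field_simp; ring
  rw [hω]
  field_simp
  ring

/-- Reverse triangle inequality for Euclidean norms of finite families. -/
lemma abs_sqrt_sum_sub_le {ι : Type*} (T : Finset ι) (f h : ι → ℝ) :
    |Real.sqrt (∑ i ∈ T, f i ^ 2) - Real.sqrt (∑ i ∈ T, h i ^ 2)| ≤
      Real.sqrt (∑ i ∈ T, (f i - h i) ^ 2) := by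
  apply Real.abs_le_sqrt
  have hF : 0 ≤ ∑ i ∈ T, f i ^ 2 := Finset.sum_nonneg fun _ _ => sq_nonneg _
  have hG : 0 ≤ ∑ i ∈ T, h i ^ 2 := Finset.sum_nonneg fun _ _ => sq_nonneg _
  have hcs := Real.sum_mul_le_sqrt_mul_sqrt T f h
  have e : ∑ i ∈ T, (f i - h i) ^ 2 =
      ∑ i ∈ T, f i ^ 2 + ∑ i ∈ T, h i ^ 2 - 2 * ∑ i ∈ T, f i * h i := by
    rw [Finset.mul_sum, ← Finset.sum_add_distrib, ← Finset.sum_sub_distrib]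
    exact Finset.sum_congr rfl fun _ _ => by ring
  rw [e, sub_sq, Real.sq_sqrt hF, Real.sq_sqrt hG]
  linarith

lemma abs_sqrt_sub_sqrt_le' (a b : ℝ) (ha : 0 ≤ a) (hb : 0 ≤ b) :
    |Real.sqrt a - Real.sqrt b| ≤ Real.sqrt |a - b| := by
  apply Real.abs_le_sqrt
  have h1 := Real.sq_sqrt ha
  have h2 := Real.sq_sqrt hb
  have h3 := Real.sqrt_nonneg a
  have h4 := Real.sqrt_nonneg b
  rcases le_total (Real.sqrt a) (Real.sqrt b) with h | h
  · refine le_trans ?_ (neg_le_abs _)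
    nlinarith
  · refine le_trans ?_ (le_abs_self _)
    nlinarith

lemma euclNorm_eq_norm {n : ℕ} (v : Fin n → ℝ) :
    euclNorm v = ‖(WithLp.toLp 2 v : EuclideanSpace ℝ (Fin n))‖ := by
  rw [EuclideanSpace.norm_eq]
  simp [euclNorm]

lemma abs_entry_le_frobNorm {m n : ℕ} (M : Matrix (Fin m) (Fin n) ℝ) (i : Fin m) (j : Fin n) :
    |M i j| ≤ frobNorm M := by
  apply Real.abs_le_sqrt
  calc M i j ^ 2 ≤ ∑ j, M i j ^ 2 :=
        Finset.single_le_sum (f := fun j => M i j ^ 2) (fun _ _ => sq_nonneg _) (Finset.mem_univ j)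
    _ ≤ _ := Finset.single_le_sum (f := fun i => ∑ j, M i j ^ 2)
        (fun _ _ => Finset.sum_nonneg fun _ _ => sq_nonneg _) (Finset.mem_univ i)

lemma solSet_fiber_bound {I J K R D : ℕ} {q α β : ℝ} (hα : 0 < α) (hβ : 0 < β)
    {g : (Fin D → ℝ) → Matrix (Fin I) (Fin J) ℝ}
    (hg : ∀ z : Fin D → ℝ, euclNorm z ≤ q → frobNorm (g z) ≤ β)
    {X : Fin I → Fin J → Fin K → ℝ} (hX : X ∈ solSet I J K R D q α g) (i : Fin I) (j : Fin J) :
    euclNorm (X i j) ≤ R * α * β := by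
  obtain ⟨z, c, hz, hc, rfl⟩ := hX
  have e : (WithLp.toLp 2 (fun k => ∑ r, g (z r) i j * c r k) : EuclideanSpace ℝ (Fin K)) =
      ∑ r, g (z r) i j • (WithLp.toLp 2 (c r) : EuclideanSpace ℝ (Fin K)) := by
    ext k
    simp
  rw [euclNorm_eq_norm, e]
  refine (norm_sum_le _ _).trans ?_
  calc _ ≤ ∑ r : Fin R, α * β := by
        refine Finset.sum_le_sum fun r _ => ?_
        rw [norm_smul, mul_comm, ← euclNorm_eq_norm, Real.norm_eq_abs]
        exact mul_le_mul (hc r) ((abs_entry_le_frobNorm _ i j).trans (hg _ (hz r)))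
          (abs_nonneg _) hα.le
    _ = _ := by simp [mul_assoc]

lemma solSet_loss_bound {I J K R D : ℕ} {q α β υ ν : ℝ} (hα : 0 < α) (hβ : 0 < β)
    (hυ : 0 ≤ υ) (hν : 0 ≤ ν)
    {g : (Fin D → ℝ) → Matrix (Fin I) (Fin J) ℝ}
    (hg : ∀ z : Fin D → ℝ, euclNorm z ≤ q → frobNorm (g z) ≤ β)
    {Y X : Fin I → Fin J → Fin K → ℝ} (hX : X ∈ solSet I J K R D q α g)
    (hY : ∀ i j k, |Y i j k| ≤ υ + ν) (i : Fin I) (j : Fin J) :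
    ∑ k, (Y i j k - X i j k) ^ 2 ≤ (Real.sqrt K * (υ + ν) + R * α * β) ^ 2 := by
  have h1 : euclNorm (Y i j) ≤ Real.sqrt K * (υ + ν) := by
    rw [euclNorm]
    apply Real.sqrt_le_iff.2 ⟨by positivity, ?_⟩
    rw [mul_pow, Real.sq_sqrt (Nat.cast_nonneg _)]
    calc _ ≤ ∑ k : Fin K, (υ + ν) ^ 2 := by
          refine Finset.sum_le_sum fun k _ => ?_
          rw [← sq_abs]
          exact pow_le_pow_left₀ (abs_nonneg _) (hY i j k) 2
      _ = _ := by simp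
  have h2 := solSet_fiber_bound hα hβ hg hX i j
  have h3 : Real.sqrt (∑ k, (Y i j k - X i j k) ^ 2) ≤ euclNorm (Y i j) + euclNorm (X i j) := by
    have : Real.sqrt (∑ k, (Y i j k - X i j k) ^ 2) =
        euclNorm (fun k => Y i j k - X i j k) := rfl
    rw [this, euclNorm_eq_norm, euclNorm_eq_norm, euclNorm_eq_norm]
    exact norm_sub_le (WithLp.toLp 2 (Y i j) : EuclideanSpace ℝ (Fin K)) (WithLp.toLp 2 (X i j))
  exact (Real.sqrt_le_left (by positivity)).1 (h3.trans (add_le_add h1 h2))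

lemma solSet_nonempty {I J K R D : ℕ} {q α : ℝ} (hq : 0 < q) (hα : 0 < α)
    (g : (Fin D → ℝ) → Matrix (Fin I) (Fin J) ℝ) : (solSet I J K R D q α g).Nonempty :=
  ⟨_, 0, 0, fun r => by simpa [euclNorm] using hq.le, fun r => by simpa [euclNorm] using hα.le, rfl⟩

lemma solSet_net {I J K R D : ℕ} {q α β : ℝ} (hα : 0 < α) (hβ : 0 < β)
    {g : (Fin D → ℝ) → Matrix (Fin I) (Fin J) ℝ}
    (hg : ∀ z : Fin D → ℝ, euclNorm z ≤ q → frobNorm (g z) ≤ β) (ε : ℝ) (hε : 0 < ε) :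
    ∃ N : Finset (Fin I → Fin J → Fin K → ℝ), ↑N ⊆ solSet I J K R D q α g ∧
      (∀ w ∈ solSet I J K R D q α g, ∃ x ∈ N, tnorm (w - x) ≤ ε) ∧
      N.card = coveringNumber (solSet I J K R D q α g) tnorm ε := by
  refine Nat.sInf_mem (s := {n : ℕ | ∃ N : Finset (Fin I → Fin J → Fin K → ℝ),
    ↑N ⊆ solSet I J K R D q α g ∧
      (∀ w ∈ solSet I J K R D q α g, ∃ x ∈ N, tnorm (w - x) ≤ ε) ∧ N.card = n}) ?_
  have hsub : solSet I J K R D q α g ⊆ Metric.closedBall 0 (R * α * β) := by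
    intro X hX
    rw [mem_closedBall_zero_iff]
    have hnn : 0 ≤ R * α * β := by positivity
    refine (pi_norm_le_iff_of_nonneg hnn).2 fun i => (pi_norm_le_iff_of_nonneg hnn).2 fun j =>
      (pi_norm_le_iff_of_nonneg hnn).2 fun k => ?_
    refine le_trans ?_ (solSet_fiber_bound hα hβ hg hX i j)
    rw [Real.norm_eq_abs]
    exact Real.abs_le_sqrt (Finset.single_le_sum (f := fun k => X i j k ^ 2)
      (fun _ _ => sq_nonneg _) (Finset.mem_univ k))
  have htb : TotallyBounded (solSet I J K R D q α g) :=
    (isCompact_closedBall (0 : Fin I → Fin J → Fin K → ℝ) (R * α * β)).totallyBounded.subset hsub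
  set S : ℝ := (I : ℝ) * J * K + 1 with hS
  have hS1 : 0 < S := by positivity
  obtain ⟨t, hts, htf, hcov⟩ := Metric.finite_approx_of_totallyBounded htb (ε / Real.sqrt S)
    (by positivity)
  refine ⟨_, htf.toFinset, by simpa using hts, ?_, rfl⟩
  intro w hw
  obtain ⟨x, hx, hwx⟩ := Set.mem_iUnion₂.1 (hcov hw)
  refine ⟨x, by simpa using hx, ?_⟩
  rw [Metric.mem_ball, dist_eq_norm] at hwx
  refine Real.sqrt_le_iff.2 ⟨hε.le, ?_⟩
  calc ∑ i, ∑ j, ∑ k, (w - x) i j k ^ 2 ≤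
        ∑ i : Fin I, ∑ j : Fin J, ∑ k : Fin K, (ε / Real.sqrt S) ^ 2 := by
        refine Finset.sum_le_sum fun i _ => Finset.sum_le_sum fun j _ =>
          Finset.sum_le_sum fun k _ => ?_
        rw [← sq_abs]
        refine pow_le_pow_left₀ (abs_nonneg _) ?_ 2
        rw [← Real.norm_eq_abs]
        exact (((norm_le_pi_norm ((w - x) i j) k).trans (norm_le_pi_norm ((w - x) i) j)).trans
          (norm_le_pi_norm (w - x) i)).trans hwx.le
    _ = (I : ℝ) * J * K * (ε ^ 2 / S) := by
        rw [div_pow, Real.sq_sqrt hS1.le]; simp; ring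
    _ ≤ ε ^ 2 := by
        rw [← mul_div_assoc, div_le_iff₀ hS1, hS]
        nlinarith [sq_nonneg ε]

lemma sqrt_loss_lipschitz {I J K : ℕ} (T : Finset (Fin I × Fin J)) (κ : ℝ) (hκ : 0 ≤ κ)
    (Y X X' : Fin I → Fin J → Fin K → ℝ) :
    |Real.sqrt (κ * ∑ p ∈ T, ∑ k, (Y p.1 p.2 k - X p.1 p.2 k) ^ 2) -
      Real.sqrt (κ * ∑ p ∈ T, ∑ k, (Y p.1 p.2 k - X' p.1 p.2 k) ^ 2)| ≤
      Real.sqrt κ * tnorm (X - X') := by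
  rw [Real.sqrt_mul hκ, Real.sqrt_mul hκ, ← mul_sub, abs_mul, abs_of_nonneg (Real.sqrt_nonneg κ)]
  refine mul_le_mul_of_nonneg_left ?_ (Real.sqrt_nonneg κ)
  have h := abs_sqrt_sum_sub_le (T ×ˢ (Finset.univ : Finset (Fin K)))
    (fun a => Y a.1.1 a.1.2 a.2 - X a.1.1 a.1.2 a.2)
    (fun a => Y a.1.1 a.1.2 a.2 - X' a.1.1 a.1.2 a.2)
  simp only [Finset.sum_product] at h
  refine h.trans (Real.sqrt_le_sqrt ?_)
  rw [← Fintype.sum_prod_type' (f := fun i j => ∑ k, (X - X') i j k ^ 2)]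
  refine (Finset.sum_le_sum_of_subset_of_nonneg (Finset.subset_univ T)
    fun _ _ _ => Finset.sum_nonneg fun _ _ => sq_nonneg _).trans (le_of_eq ?_)
  refine Finset.sum_congr rfl fun p _ => Finset.sum_congr rfl fun k _ => ?_
  simp only [Pi.sub_apply]
  ring

open Classical in
/-- Lemma 1 of the paper: uniform concentration of the empirical sampling loss over the
solution set.  With probability at least `1 − δ` over a uniformly random size-`m` subset `Ω`
of `[I]×[J]`, `Gap⋆(Ω) ≤ 2cR/√m + ((ξ²ω/2)·log(2N(X(R,g),cR)/δ))^{1/4}`. -/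
theorem gap_star_bound (I J K R D m : ℕ)
    (hI : 0 < I) (hJ : 0 < J) (hK : 0 < K) (hR : 0 < R) (hD : 0 < D)
    (hm : 1 ≤ m) (hmIJ : m ≤ I * J)
    (q α β υ ν : ℝ) (hq : 0 < q) (hα : 0 < α) (hβ : 0 < β) (hυ : 0 ≤ υ) (hν : 0 ≤ ν)
    (g : (Fin D → ℝ) → Matrix (Fin I) (Fin J) ℝ)
    (hg : ∀ z : Fin D → ℝ, euclNorm z ≤ q → frobNorm (g z) ≤ β)
    (Xnat Noise Y : Fin I → Fin J → Fin K → ℝ)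
    (hXb : ∀ i j k, |Xnat i j k| ≤ υ) (hNb : ∀ i j k, |Noise i j k| ≤ ν)
    (hY : Y = Xnat + Noise)
    (c δ : ℝ) (hc : 0 < c) (hδ : 0 < δ) (hδ1 : δ < 1) :
    (1 - δ) * ((((Finset.univ : Finset (Fin I × Fin J)).powersetCard m).card : ℝ)) ≤
    ((((Finset.univ : Finset (Fin I × Fin J)).powersetCard m).filter
        (fun s =>
          (⨆ X : ↥(solSet I J K R D q α g),
            |Real.sqrt ((1 / ((m : ℝ) * K)) *
                ∑ p ∈ s, ∑ k, (Y p.1 p.2 k - X.1 p.1 p.2 k) ^ 2) -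
              Real.sqrt ((1 / ((I : ℝ) * J * K)) *
                ∑ i, ∑ j, ∑ k, (Y i j k - X.1 i j k) ^ 2)|) ≤
          2 * c * R / Real.sqrt m +
          ((((1 / (K : ℝ)) * (Real.sqrt K * (υ + ν) + R * α * β) ^ 2) ^ 2 *
              (1 / (m : ℝ) - 1 / ((I : ℝ) * J) + 1 / ((I : ℝ) * J * m)) / 2) *
            Real.log (2 * (coveringNumber (solSet I J K R D q α g) tnorm (c * R) : ℝ) / δ)) ^
            ((1 : ℝ) / 4))).card : ℝ) := by
  set W := solSet I J K R D q α g with hW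
  set ξ : ℝ := (1 / (K : ℝ)) * (Real.sqrt K * (υ + ν) + R * α * β) ^ 2 with hξ
  set ω : ℝ := 1 / (m : ℝ) - 1 / ((I : ℝ) * J) + 1 / ((I : ℝ) * J * m) with hω
  have hI' : (0 : ℝ) < I := by exact_mod_cast hI
  have hJ' : (0 : ℝ) < J := by exact_mod_cast hJ
  have hK' : (0 : ℝ) < K := by exact_mod_cast hK
  have hK1 : (1 : ℝ) ≤ K := by exact_mod_cast hK
  have hR' : (0 : ℝ) < R := by exact_mod_cast hR
  have hm' : (0 : ℝ) < m := by exact_mod_cast hm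
  have hmIJ' : (m : ℝ) ≤ I * J := by exact_mod_cast hmIJ
  have hξpos : 0 < ξ := by positivity
  have hωpos : 0 < ω := by
    have e : ω = ((I : ℝ) * J - m + 1) / ((I : ℝ) * J * m) := by
      rw [hω]; field_simp
    rw [e]
    apply div_pos (by linarith) (by positivity)
  obtain ⟨N, hNW, hNcov, hNcard⟩ := solSet_net (K := K) (R := R) hα hβ hg (c * R) (by positivity)
  rw [← hW] at hNW hNcov hNcard
  have hWne : W.Nonempty := solSet_nonempty hq hα g
  have hNpos : (1 : ℝ) ≤ N.card := by
    obtain ⟨w, hw⟩ := hWne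
    obtain ⟨x, hx, _⟩ := hNcov w hw
    exact_mod_cast Finset.card_pos.2 ⟨x, hx⟩
  rw [← hNcard]
  set Λ : ℝ := Real.log (2 * (N.card : ℝ) / δ) with hΛ
  have hΛpos : 0 < Λ := by
    apply Real.log_pos
    rw [lt_div_iff₀ hδ]
    linarith
  set B : ℝ := ξ ^ 2 * ω / 2 * Λ with hB
  have hBpos : 0 < B := by positivity
  set u : ℝ := Real.sqrt B with hu
  have hupos : 0 < u := Real.sqrt_pos.2 hBpos
  have hB4 : B ^ ((1 : ℝ) / 4) = Real.sqrt u := by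
    rw [hu, Real.sqrt_eq_rpow, Real.sqrt_eq_rpow, ← Real.rpow_mul hBpos.le]
    norm_num
  rw [hB4]
  have hYb : ∀ i j k, |Y i j k| ≤ υ + ν := by
    intro i j k
    rw [hY]
    exact (abs_add_le _ _).trans (add_le_add (hXb i j k) (hNb i j k))
  -- the normalized losses
  set x : (Fin I → Fin J → Fin K → ℝ) → Fin I × Fin J → ℝ :=
    fun X p => (1 / (K : ℝ)) * ∑ k, (Y p.1 p.2 k - X p.1 p.2 k) ^ 2 with hx
  have hx0 : ∀ X p, 0 ≤ x X p := fun X p =>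
    mul_nonneg (by positivity) (Finset.sum_nonneg fun _ _ => sq_nonneg _)
  have hxb : ∀ X ∈ W, ∀ p, x X p ≤ ξ := fun X hX p =>
    mul_le_mul_of_nonneg_left (solSet_loss_bound hα hβ hυ hν hg hX hYb p.1 p.2) (by positivity)
  have hn : (Fintype.card (Fin I × Fin J) : ℝ) = (I : ℝ) * J := by simp
  set P := (Finset.univ : Finset (Fin I × Fin J)).powersetCard m with hP
  let bad : ℝ → (Fin I → Fin J → Fin K → ℝ) → Finset (Finset (Fin I × Fin J)) := fun ε X =>
    P.filter fun s => u ≤ ε * ((∑ p ∈ s, x X p) / m -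
      (∑ p, x X p) / Fintype.card (Fin I × Fin J))
  have hbad : ∀ ε : ℝ, (ε = 1 ∨ ε = -1) → ∀ X ∈ N,
      ((bad ε X).card : ℝ) ≤ P.card * (δ / (2 * N.card)) := by
    intro ε hε X hX
    have h := serfling_tail (x X) ξ hξpos (hx0 X) (hxb X (hNW hX)) m hm (by simpa using hmIJ)
      u hupos ε hε
    rw [hn, ← hω] at h
    have e : Real.exp (-(2 * u ^ 2 / (ξ ^ 2 * ω))) = δ / (2 * N.card) := by
      have : 2 * u ^ 2 / (ξ ^ 2 * ω) = Λ := by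
        rw [hu, Real.sq_sqrt hBpos.le, hB]
        field_simp
      rw [this, Real.exp_neg, hΛ, Real.exp_log (by positivity), inv_div]
    rw [e] at h
    refine le_trans (le_of_eq ?_) h
    simp only [bad, hn]
    rw [hP]
  set U : Finset (Finset (Fin I × Fin J)) := N.biUnion fun X => bad 1 X ∪ bad (-1) X with hU
  have hUcard : (U.card : ℝ) ≤ δ * P.card := by
    have h1 : (U.card : ℝ) ≤ ∑ X ∈ N, ((bad 1 X ∪ bad (-1) X).card : ℝ) := by
      rw [← Nat.cast_sum]
      exact Nat.cast_le.2 Finset.card_biUnion_le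
    have h2 : ∑ X ∈ N, ((bad 1 X ∪ bad (-1) X).card : ℝ) ≤
        ∑ X ∈ N, (2 * (P.card * (δ / (2 * N.card))) : ℝ) := by
      refine Finset.sum_le_sum fun X hX => ?_
      have h3 : ((bad 1 X ∪ bad (-1) X).card : ℝ) ≤ (bad 1 X).card + (bad (-1) X).card := by
        exact_mod_cast Finset.card_union_le _ _
      have h4 := hbad 1 (Or.inl rfl) X hX
      have h5 := hbad (-1) (Or.inr rfl) X hX
      linarith
    refine h1.trans (h2.trans (le_of_eq ?_))
    rw [Finset.sum_const, nsmul_eq_mul]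
    field_simp
  have hgood : ∀ s ∈ P \ U, (⨆ X : ↥W,
            |Real.sqrt ((1 / ((m : ℝ) * K)) *
                ∑ p ∈ s, ∑ k, (Y p.1 p.2 k - X.1 p.1 p.2 k) ^ 2) -
              Real.sqrt ((1 / ((I : ℝ) * J * K)) *
                ∑ i, ∑ j, ∑ k, (Y i j k - X.1 i j k) ^ 2)|) ≤
          2 * c * R / Real.sqrt m + Real.sqrt u := by
    intro s hs
    obtain ⟨hsP, hsU⟩ := Finset.mem_sdiff.1 hs
    have : Nonempty ↥W := hWne.to_subtype
    refine ciSup_le fun X => ?_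
    obtain ⟨X', hX'N, hd⟩ := hNcov X.1 X.2
    have hflat : ∀ Z : Fin I → Fin J → Fin K → ℝ, ∑ i, ∑ j, ∑ k, (Y i j k - Z i j k) ^ 2 =
        ∑ p : Fin I × Fin J, ∑ k, (Y p.1 p.2 k - Z p.1 p.2 k) ^ 2 := fun Z =>
      (Fintype.sum_prod_type' (f := fun i j => ∑ k, (Y i j k - Z i j k) ^ 2)).symm
    rw [hflat]
    have hL : ∀ κ : ℝ, 0 < κ → (m : ℝ) ≤ κ → Real.sqrt (1 / κ) * tnorm (X.1 - X') ≤
        c * R / Real.sqrt m := by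
      intro κ hκ hmκ
      have h1 : Real.sqrt (1 / κ) ≤ 1 / Real.sqrt m := by
        rw [← Real.sqrt_one, ← Real.sqrt_div zero_le_one]
        rw [Real.sqrt_one]
        exact Real.sqrt_le_sqrt (one_div_le_one_div_of_le hm' hmκ)
      calc _ ≤ 1 / Real.sqrt m * (c * R) :=
            mul_le_mul h1 hd (Real.sqrt_nonneg _) (by positivity)
        _ = _ := by ring
    have hA := (sqrt_loss_lipschitz s (1 / ((m : ℝ) * K)) (by positivity) Y X.1 X').trans
      (hL _ (by positivity) (le_mul_of_one_le_right hm'.le hK1))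
    have hC := (sqrt_loss_lipschitz Finset.univ (1 / ((I : ℝ) * J * K)) (by positivity)
      Y X.1 X').trans (hL _ (by positivity)
        (hmIJ'.trans (le_mul_of_one_le_right (by positivity) hK1)))
    have e1 : (1 / ((m : ℝ) * K)) * ∑ p ∈ s, ∑ k, (Y p.1 p.2 k - X' p.1 p.2 k) ^ 2 =
        (∑ p ∈ s, x X' p) / m := by
      simp only [hx]
      rw [← Finset.mul_sum]
      field_simp
    have e2 : (1 / ((I : ℝ) * J * K)) * ∑ p : Fin I × Fin J, ∑ k, (Y p.1 p.2 k - X' p.1 p.2 k) ^ 2 =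
        (∑ p, x X' p) / Fintype.card (Fin I × Fin J) := by
      simp only [hx]
      rw [← Finset.mul_sum, hn]
      field_simp
    rw [e1] at hA
    rw [e2] at hC
    have hns : s ∉ bad 1 X' ∪ bad (-1) X' := fun h =>
      hsU (Finset.mem_biUnion.2 ⟨X', hX'N, h⟩)
    rw [Finset.mem_union, not_or] at hns
    have hb1 := fun h => hns.1 (Finset.mem_filter.2 ⟨hsP, h⟩)
    have hb2 := fun h => hns.2 (Finset.mem_filter.2 ⟨hsP, h⟩)
    rw [imp_false, not_le] at hb1 hb2
    have hmid : |Real.sqrt ((∑ p ∈ s, x X' p) / m) -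
        Real.sqrt ((∑ p, x X' p) / Fintype.card (Fin I × Fin J))| ≤ Real.sqrt u := by
      refine (abs_sqrt_sub_sqrt_le' _ _
        (div_nonneg (Finset.sum_nonneg fun p _ => hx0 X' p) hm'.le)
        (div_nonneg (Finset.sum_nonneg fun p _ => hx0 X' p) (Nat.cast_nonneg _))).trans
        (Real.sqrt_le_sqrt (abs_le.2 ⟨by linarith, by linarith⟩))
    have e3 : 2 * c * R / Real.sqrt m = c * R / Real.sqrt m + c * R / Real.sqrt m := by ring
    rw [e3]
    rw [abs_le] at hA hC hmid ⊢
    constructor <;> linarith [hA.1, hA.2, hC.1, hC.2, hmid.1, hmid.2]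
  have hsubset : P \ U ⊆ P.filter (fun s => (⨆ X : ↥W,
            |Real.sqrt ((1 / ((m : ℝ) * K)) *
                ∑ p ∈ s, ∑ k, (Y p.1 p.2 k - X.1 p.1 p.2 k) ^ 2) -
              Real.sqrt ((1 / ((I : ℝ) * J * K)) *
                ∑ i, ∑ j, ∑ k, (Y i j k - X.1 i j k) ^ 2)|) ≤
          2 * c * R / Real.sqrt m + Real.sqrt u) := fun s hs =>
    Finset.mem_filter.2 ⟨(Finset.mem_sdiff.1 hs).1, hgood s hs⟩
  have hcard : ((P \ U).card : ℝ) ≤ _ := Nat.cast_le.2 (Finset.card_le_card hsubset)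
  refine le_trans ?_ hcard
  have h6 : (P.card : ℝ) ≤ (P \ U).card + U.card := by
    have := Finset.card_le_card_sdiff_add_card (s := P) (t := U)
    exact_mod_cast this
  linarith
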